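/- arXiv:2412.18520 — 3 statements merged into one kernel-verified Lean document; each statement's English description precedes it below -/
import Mathlib

section
/- Fix a rational number r > 1. For every periodic pair (c, n) — i.e., c ∈ ℝ and n ≥ 1 a natural number such that f_{c,r}^n(0) = 0 and f_{c,r}^j(0) ≠ 0 for all j with 1 ≤ j ≤ n−1 — the function g_n : ℝ → ℝ defined by g_n(t) = f_{t,r}^n(0) is differentiable at t = c and its derivative at c is nonzero. -/
/-- The real numbers carry a valuation for which a given prime number is topologically small. -/
theorem exists_real_valuationSubring_prime_lt_one (l : ℕ) (hl : l.Prime) :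
    ∃ B : ValuationSubring ℝ, B.valuation (l : ℝ) < 1 := by
  let A : Subring ℝ := (Int.castRingHom ℝ).range
  let a : A := ⟨(l : ℝ), ⟨(l : ℤ), by simp⟩⟩
  have hI : Ideal.span {a} ≠ ⊤ := by
    rw [Ne, Ideal.span_singleton_eq_top]
    rintro h
    obtain ⟨⟨_, m, rfl⟩, hm⟩ := h.exists_right_inv
    have h1 : (l : ℝ) * (m : ℝ) = 1 := by simpa [a] using congrArg Subtype.val hm
    have h2 : (l : ℤ) * m = 1 := by exact_mod_cast h1
    have h3 := Int.natAbs_dvd_natAbs.mpr (Dvd.intro m h2)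
    exact hl.one_lt.ne' (Nat.dvd_one.mp (by simpa using h3))
  obtain ⟨B, -, hB⟩ := Ideal.image_subset_nonunits_valuationSubring _ hI
  exact ⟨B, hB ⟨a, Ideal.subset_span rfl, rfl⟩⟩

theorem Valuation.map_intCast_le_one {K Γ : Type*} [Field K] [LinearOrderedCommGroupWithZero Γ]
    (v : Valuation K Γ) (m : ℤ) : v (m : K) ≤ 1 :=
  intCast_mem v.integer m

/-- Every rational number greater than one is topologically small for some valuation on `ℝ`. -/
theorem exists_real_valuationSubring_ratCast_lt_one (r : ℚ) (hr : 1 < r) :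
    ∃ B : ValuationSubring ℝ, B.valuation (r : ℝ) < 1 := by
  have hnum : (r.den : ℤ) < r.num := by simpa [Rat.lt_iff] using hr
  have hden := r.den_pos
  have hne : r.num.natAbs ≠ 1 := by omega
  obtain ⟨l, hl, m, hm⟩ := Nat.exists_prime_and_dvd hne
  have hlden : l.Coprime r.den := r.reduced.coprime_dvd_left ⟨m, hm⟩
  obtain ⟨B, hB⟩ := exists_real_valuationSubring_prime_lt_one l hl
  have hnumv : B.valuation (r.num : ℝ) < 1 := by
    obtain ⟨k, hk⟩ := Int.natCast_dvd.mpr (Dvd.intro m hm.symm)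
    rw [hk]
    push_cast
    rw [map_mul]
    exact mul_lt_one_of_nonneg_of_lt_one_left zero_le hB (B.valuation.map_intCast_le_one k)
  have hdenv : B.valuation (r.den : ℝ) = 1 := by
    refine le_antisymm (by simpa only [Int.cast_natCast] using B.valuation.map_intCast_le_one (r.den : ℤ)) ?_
    by_contra! h
    obtain ⟨a, b, hab⟩ := Int.isCoprime_iff_gcd_eq_one.mpr (show Int.gcd l r.den = 1 from hlden)
    have hab' : (a : ℝ) * l + b * r.den = 1 := by exact_mod_cast hab
    have := B.valuation.map_add_lt (x := (a : ℝ) * l) (y := b * r.den) (g := 1)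
      (by rw [map_mul]; exact mul_lt_one_of_nonneg_of_lt_one_right (B.valuation.map_intCast_le_one a) zero_le hB)
      (by rw [map_mul]; exact mul_lt_one_of_nonneg_of_lt_one_right (B.valuation.map_intCast_le_one b) zero_le h)
    rw [hab', map_one] at this
    exact this.false
  refine ⟨B, ?_⟩
  rw [Rat.cast_def, map_div₀, hdenv, div_one]
  exact hnumv

section RealPower

variable {Γ : Type*} [LinearOrderedCommGroupWithZero Γ] (v : Valuation ℝ Γ)

theorem Valuation.map_abs (x : ℝ) : v |x| = v x := by
  rcases abs_choice x with h | h <;> simp [h]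

theorem Valuation.map_abs_rpow_div_pow (x : ℝ) (p : ℕ) {q : ℕ} (hq : q ≠ 0) :
    v (|x| ^ ((p : ℝ) / q)) ^ q = v x ^ p := by
  rw [← map_pow, ← Real.rpow_mul_natCast (abs_nonneg x), div_mul_cancel₀ _ (by exact_mod_cast hq),
    Real.rpow_natCast, map_pow, v.map_abs]

theorem Rat.exists_natCast_div_eq {r : ℚ} (hr : 0 ≤ r) :
    ∃ p q : ℕ, q ≠ 0 ∧ (r : ℝ) = (p : ℝ) / q := by
  refine ⟨r.num.toNat, r.den, r.den_nz, ?_⟩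
  have h : ((r.num.toNat : ℤ) : ℝ) = r.num := by rw [Int.toNat_of_nonneg (Rat.num_nonneg.mpr hr)]
  rw [Rat.cast_def, ← h, Int.cast_natCast]

theorem Valuation.map_abs_rpow_le_one {r : ℚ} (hr : 0 ≤ r) {x : ℝ} (hx : v x ≤ 1) :
    v (|x| ^ (r : ℝ)) ≤ 1 := by
  obtain ⟨p, q, hq, h⟩ := Rat.exists_natCast_div_eq hr
  rw [h, ← pow_le_one_iff_of_nonneg zero_le hq, v.map_abs_rpow_div_pow x p hq]
  exact pow_le_one₀ zero_le hx

theorem Valuation.lt_map_abs_rpow {r : ℚ} (hr : 1 < r) {x : ℝ} (hx : 1 < v x) :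
    v x < v (|x| ^ (r : ℝ)) := by
  obtain ⟨p, q, hq, h⟩ := Rat.exists_natCast_div_eq (zero_le_one.trans hr.le)
  have hpq : q < p := by
    have h1 : (1 : ℝ) < (p : ℝ) / q := by rw [← h]; exact_mod_cast hr
    rw [one_lt_div (by positivity)] at h1
    exact_mod_cast h1
  rw [h]
  refine lt_of_pow_lt_pow_left₀ q zero_le ?_
  rw [v.map_abs_rpow_div_pow x p hq]
  exact pow_lt_pow_right₀ hx hpq

theorem Valuation.map_le_one_of_iterate_eq_zero {r : ℚ} (hr : 1 < r) {c : ℝ} {n : ℕ} (hn : 1 ≤ n)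
    (h : (fun x : ℝ => |x| ^ (r : ℝ) + c)^[n] 0 = 0) : v c ≤ 1 := by
  by_contra! hc
  have hr0 : (r : ℝ) ≠ 0 := by exact_mod_cast (zero_lt_one.trans hr).ne'
  have key : v c ≤ v ((fun x : ℝ => |x| ^ (r : ℝ) + c)^[n] 0) := by
    clear h
    induction n, hn using Nat.le_induction with
    | base => simp [Real.zero_rpow hr0]
    | succ k _ ih =>
      have hlt := v.lt_map_abs_rpow hr (hc.trans_le ih)
      rw [Function.iterate_succ_apply', v.map_add_eq_of_lt_left (ih.trans_lt hlt)]
      exact ih.trans hlt.le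
  rw [h, map_zero] at key
  exact (zero_le.trans_lt hc).not_ge (key.trans zero_le)

theorem Valuation.map_iterate_le_one {r : ℚ} (hr : 0 ≤ r) {c : ℝ} (hc : v c ≤ 1) (n : ℕ) :
    v ((fun x : ℝ => |x| ^ (r : ℝ) + c)^[n] 0) ≤ 1 := by
  induction n with
  | zero => simp
  | succ k ih =>
    rw [Function.iterate_succ_apply']
    exact v.map_add_le (v.map_abs_rpow_le_one hr ih) hc

theorem Valuation.map_abs_rpow_sub_two_mul_self_le_one {r : ℚ} (hr : 1 < r) {x : ℝ}
    (hx : v x ≤ 1) : v (|x| ^ ((r : ℝ) - 2) * x) ≤ 1 := by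
  rcases eq_or_ne x 0 with rfl | h0
  · simp
  have h : |x| ^ ((r : ℝ) - 2) * |x| = |x| ^ ((r - 1 : ℚ) : ℝ) := by
    rw [← Real.rpow_add_one (abs_ne_zero.mpr h0)]
    push_cast
    ring_nf
  rw [map_mul, ← v.map_abs x, ← map_mul, h]
  exact v.map_abs_rpow_le_one (sub_nonneg.mpr hr.le) hx

/-- If `v r < 1` and `v c ≤ 1`, the parameter derivative of the critical orbit is a `v`-unit. -/
theorem Valuation.exists_hasDerivAt_iterate_map_eq_one {r : ℚ} (hr : 1 < r) (hvr : v (r : ℝ) < 1)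
    {c : ℝ} (hc : v c ≤ 1) {n : ℕ} (hn : 1 ≤ n) :
    ∃ d : ℝ, HasDerivAt (fun t : ℝ => (fun x : ℝ => |x| ^ (r : ℝ) + t)^[n] 0) d c ∧ v d = 1 := by
  have hr0 : (r : ℝ) ≠ 0 := by exact_mod_cast (zero_lt_one.trans hr).ne'
  induction n, hn using Nat.le_induction with
  | base => exact ⟨1, by simpa [Real.zero_rpow hr0] using hasDerivAt_id' c, map_one v⟩
  | succ k _ ih =>
    obtain ⟨d, hd, hvd⟩ := ih
    set y := (fun x : ℝ => |x| ^ (r : ℝ) + c)^[k] 0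
    refine ⟨r * |y| ^ ((r : ℝ) - 2) * y * d + 1, ?_, ?_⟩
    · have hr1 : 1 < (r : ℝ) := by exact_mod_cast hr
      simp only [Function.iterate_succ_apply']
      exact ((hasDerivAt_abs_rpow y hr1).comp c hd).add (hasDerivAt_id' c)
    · have hvy := v.map_abs_rpow_sub_two_mul_self_le_one hr
        (v.map_iterate_le_one (zero_le_one.trans hr.le) hc k)
      rw [v.map_add_eq_of_lt_right, map_one]
      rw [map_one, map_mul, hvd, mul_one, mul_assoc, map_mul]
      exact mul_lt_one_of_nonneg_of_lt_one_left zero_le hvr hvy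

end RealPower


/-- For a fixed rational `r > 1` and a periodic pair `(c, n)` for
`f_{c,r}(x) = |x|^r + c`, the function `g_n(t) = f_{t,r}^n(0)` is differentiable
at `t = c` with nonzero derivative. -/
theorem stmt_0 (r : ℚ) (hr : 1 < r) (c : ℝ) (n : ℕ) (hn : 1 ≤ n)
    (hper : (fun x : ℝ => |x| ^ (r : ℝ) + c)^[n] 0 = 0)
    (hprim : ∀ j : ℕ, 1 ≤ j → j ≤ n - 1 →
      (fun x : ℝ => |x| ^ (r : ℝ) + c)^[j] 0 ≠ 0) :
    DifferentiableAt ℝ (fun t : ℝ => (fun x : ℝ => |x| ^ (r : ℝ) + t)^[n] 0) c ∧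
    deriv (fun t : ℝ => (fun x : ℝ => |x| ^ (r : ℝ) + t)^[n] 0) c ≠ 0 := by
  obtain ⟨B, hB⟩ := exists_real_valuationSubring_ratCast_lt_one r hr
  obtain ⟨d, hd, hvd⟩ := B.valuation.exists_hasDerivAt_iterate_map_eq_one hr hB
    (B.valuation.map_le_one_of_iterate_eq_zero hr hn hper) hn
  refine ⟨hd.differentiableAt, ?_⟩
  rw [hd.deriv]
  rintro rfl
  simp at hvd
end

section
/- Fix a rational number r > 1. Let c ∈ ℝ be an algebraic integer (i.e., integral over ℤ) and let n ≥ 1 be such that f_{c,r}^j(0) ≠ 0 for all j with 1 ≤ j ≤ n−1. Then the function g_n(t) = f_{t,r}^n(0) is differentiable at t = c and g_n'(c) ≠ 0. -/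
theorem IsIntegral.rpow_ratCast {x : ℝ} (hx : IsIntegral ℤ x) (hx0 : 0 ≤ x) {s : ℚ} (hs : 0 ≤ s) :
    IsIntegral ℤ (x ^ (s : ℝ)) := by
  refine IsIntegral.of_pow s.den_pos ?_
  have h : (x ^ (s : ℝ)) ^ s.den = x ^ s.num.toNat := by
    rw [← Real.rpow_natCast, ← Real.rpow_mul hx0, ← Real.rpow_natCast]
    congr 1
    have h1 : (s : ℝ) * s.den = s.num := mod_cast Rat.mul_den_eq_num s
    have h2 : ((s.num.toNat : ℤ) : ℝ) = s.num := by
      rw [Int.toNat_of_nonneg (Rat.num_nonneg.2 hs)]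
    rw [h1, ← h2, Int.cast_natCast]
  rw [h]
  exact hx.pow _

theorem IsIntegral.abs {x : ℝ} (hx : IsIntegral ℤ x) : IsIntegral ℤ |x| := by
  rcases abs_choice x with h | h <;> rw [h]
  exacts [hx, hx.neg]

theorem IsIntegral.abs_rpow_sub_two_mul {x : ℝ} (hx : IsIntegral ℤ x) {r : ℚ} (hr : 1 < r) :
    IsIntegral ℤ (|x| ^ ((r : ℝ) - 2) * x) := by
  rcases eq_or_ne x 0 with rfl | h0
  · simpa using isIntegral_zero
  have h : |x| ^ ((r : ℝ) - 2) * |x| = |x| ^ ((r - 1 : ℚ) : ℝ) := by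
    rw [← Real.rpow_add_one (abs_ne_zero.2 h0)]
    congr 1
    push_cast
    ring
  have hi := hx.abs.rpow_ratCast (abs_nonneg x) (sub_nonneg.2 hr.le)
  rw [← h] at hi
  rcases abs_choice x with h' | h'
  · rwa [h'] at hi ⊢
  · simpa [h'] using hi.neg

theorem isIntegral_iterate_abs_rpow_add {r : ℚ} (hr : 0 ≤ r) {c : ℝ} (hc : IsIntegral ℤ c) (n : ℕ) :
    IsIntegral ℤ ((fun x : ℝ => |x| ^ (r : ℝ) + c)^[n] 0) := by
  induction n with
  | zero => exact isIntegral_zero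
  | succ n ih =>
    rw [Function.iterate_succ_apply']
    exact (ih.abs.rpow_ratCast (abs_nonneg _) hr).add hc

/-- The derivative of `t ↦ f_{t,r}^{n+1}(0)` at an algebraic integer is congruent to `1` modulo the
numerator of `r`, after clearing powers of the denominator. -/
theorem exists_hasDerivAt_iterate_abs_rpow_add {r : ℚ} (hr : 1 < r) {c : ℝ} (hc : IsIntegral ℤ c)
    (n : ℕ) :
    ∃ D a : ℝ, HasDerivAt (fun t : ℝ => (fun x : ℝ => |x| ^ (r : ℝ) + t)^[n + 1] 0) D c ∧
      IsIntegral ℤ a ∧ (r.den : ℝ) ^ n * D = (r.den : ℝ) ^ n + r.num * a := by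
  induction n with
  | zero =>
    refine ⟨1, 0, ?_, isIntegral_zero, by simp⟩
    simpa using (hasDerivAt_id c).const_add (|(0 : ℝ)| ^ (r : ℝ))
  | succ n ih =>
    obtain ⟨D, a, hD, ha, h⟩ := ih
    set y := (fun x : ℝ => |x| ^ (r : ℝ) + c)^[n + 1] 0 with hy
    have hr' : (1 : ℝ) < r := mod_cast hr
    have hb : IsIntegral ℤ (|y| ^ ((r : ℝ) - 2) * y) :=
      (isIntegral_iterate_abs_rpow_add (by linarith) hc _).abs_rpow_sub_two_mul hr
    have hq (k : ℕ) : IsIntegral ℤ ((r.den : ℝ) ^ k) := (isIntegral_natCast _).pow k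
    have hp : IsIntegral ℤ (r.num : ℝ) := isIntegral_intCast _
    refine ⟨r * |y| ^ ((r : ℝ) - 2) * y * D + 1,
      |y| ^ ((r : ℝ) - 2) * y * ((r.den : ℝ) ^ n + r.num * a), ?_,
      hb.mul ((hq n).add (hp.mul ha)), ?_⟩
    · simp only [Function.iterate_succ_apply' _ (n + 1)]
      exact ((hasDerivAt_abs_rpow y hr').comp c hD).add (hasDerivAt_id c)
    · have h1 : (r : ℝ) * r.den = r.num := mod_cast Rat.mul_den_eq_num r
      rw [← h, ← h1]
      ring

theorem not_isIntegral_of_den_pow_add_num_mul_eq_zero {r : ℚ} (hr : 1 < r) {n : ℕ} {a : ℝ}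
    (h : (r.den : ℝ) ^ n + r.num * a = 0) : ¬ IsIntegral ℤ a := by
  intro ha
  have hp : (1 : ℤ) < r.num := by
    have h1 : (r.den : ℤ) < r.num := by
      have h2 : (1 : ℚ) < r.num / r.den := by rwa [Rat.num_div_den]
      rw [one_lt_div (mod_cast r.den_pos)] at h2
      exact_mod_cast h2
    have := r.den_pos
    lia
  have hp0 : (r.num : ℝ) ≠ 0 := by exact_mod_cast (by lia : r.num ≠ 0)
  have ha' : a = algebraMap ℚ ℝ (-(r.den : ℚ) ^ n / r.num) := by
    simp
    field_simp
    linarith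
  rw [ha', isIntegral_algebraMap_iff (algebraMap ℚ ℝ).injective] at ha
  obtain ⟨m, hm⟩ := IsIntegrallyClosed.isIntegral_iff.1 ha
  have hmul : (r.den : ℤ) ^ n = r.num * -m := by
    have hp1 : (r.num : ℚ) ≠ 0 := by exact_mod_cast hp0
    have : (r.den : ℚ) ^ n = r.num * -m := by
      rw [eq_intCast, eq_div_iff hp1] at hm
      linarith
    exact_mod_cast this
  have hcop : IsCoprime r.num ((r.den : ℤ) ^ n) := r.isCoprime_num_den.pow_right
  have hu := hcop.isUnit_of_dvd' dvd_rfl ⟨_, hmul⟩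
  rcases Int.isUnit_iff.1 hu with h' | h' <;> lia

/-- For a fixed rational `r > 1`, if `c` is an algebraic integer and
`f_{c,r}^j(0) ≠ 0` for all `1 ≤ j ≤ n - 1` (with `n ≥ 1`), then `g_n(t) = f_{t,r}^n(0)`
is differentiable at `t = c` with nonzero derivative. -/
theorem stmt_2 (r : ℚ) (hr : 1 < r) (c : ℝ) (hc : IsIntegral ℤ c) (n : ℕ) (hn : 1 ≤ n)
    (hprim : ∀ j : ℕ, 1 ≤ j → j ≤ n - 1 →
      (fun x : ℝ => |x| ^ (r : ℝ) + c)^[j] 0 ≠ 0) :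
    DifferentiableAt ℝ (fun t : ℝ => (fun x : ℝ => |x| ^ (r : ℝ) + t)^[n] 0) c ∧
    deriv (fun t : ℝ => (fun x : ℝ => |x| ^ (r : ℝ) + t)^[n] 0) c ≠ 0 := by
  obtain ⟨k, rfl⟩ := Nat.exists_eq_add_of_le' hn
  obtain ⟨D, a, hD, ha, h⟩ := exists_hasDerivAt_iterate_abs_rpow_add hr hc k
  refine ⟨hD.differentiableAt, ?_⟩
  rw [hD.deriv]
  rintro rfl
  exact not_isIntegral_of_den_pow_add_num_mul_eq_zero hr (by rw [← h, mul_zero]) ha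
end

section
/- Let r = p/q with p > q ≥ 1 coprime positive integers and let c < 0 be a real number. Set s := −(−c)^{(p−q)/q} (real power of the positive number −c). Then c is an algebraic integer if and only if s is an algebraic integer. -/
/-- Let `r = p/q` with `p > q ≥ 1` coprime positive integers and `c < 0`.
Set `s := -(-c)^((p-q)/q)`. Then `c` is an algebraic integer iff `s` is. -/
theorem stmt_8 (p q : ℕ) (hq : 1 ≤ q) (hpq : q < p) (hcop : Nat.Coprime p q)
    (c : ℝ) (hc : c < 0) :
    IsIntegral ℤ c ↔
      IsIntegral ℤ (-((-c) ^ (((p : ℝ) - (q : ℝ)) / (q : ℝ)))) := by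
  have hq0 : (q : ℝ) ≠ 0 := by positivity
  have key : ((-c) ^ (((p : ℝ) - (q : ℝ)) / (q : ℝ))) ^ q = (-c) ^ (p - q) := by
    rw [← Real.rpow_natCast, ← Real.rpow_mul (by linarith), div_mul_cancel₀ _ hq0,
      ← Nat.cast_sub hpq.le, Real.rpow_natCast]
  rw [IsIntegral.neg_iff, ← IsIntegral.neg_iff (x := c)]
  constructor
  · intro h
    exact IsIntegral.of_pow hq (key ▸ h.pow (p - q))
  · intro h
    exact IsIntegral.of_pow (Nat.sub_pos_of_lt hpq) (key ▸ h.pow q)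
end
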